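/- Let $G$ be a connected graph of bounded degree satisfying the anchored isoperimetric inequality $|\partial A| \ge C_{IS}|A|$ for every finite connected $A$ containing the root $o$. Then the simple random walk on $G$ started at $o$ is transient. -/

import Mathlib

open scoped Classical BigOperators

noncomputable def kerPow {V : Type*} (q : V → V → ℝ) : ℕ → V → V → ℝ
  | 0 => fun x y => if x = y then 1 else 0
  | n + 1 => fun x y => ∑' z, kerPow q n x z * q z y

/-- The simple random-walk kernel of a locally finite graph. -/
noncomputable def srwKernel {V : Type*} (G : SimpleGraph V) [G.LocallyFinite] :
    V → V → ℝ :=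
  fun x y => if G.Adj x y then ((G.degree x : ℝ))⁻¹ else 0

lemma s13_conn {V : Type*} (G : SimpleGraph V) [G.LocallyFinite] (hGconn : G.Connected)
    (o : V) (g : V → ℝ) (A : Finset V) (t : ℝ) (hA : ∀ x, x ∈ A ↔ t < g x)
    (ho : o ∈ A)
    (hg : ∀ x, ∑ z ∈ G.neighborFinset x, (g x - g z) ≤ if x = o then 1 else 0) :
    ∀ x ∈ A, Relation.ReflTransGen (fun a b => G.Adj a b ∧ a ∈ A ∧ b ∈ A) o x := by
  by_contra hcon
  push Not at hcon
  obtain ⟨x0, hx0, hx0'⟩ := hcon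
  set R := Relation.ReflTransGen (fun a b => G.Adj a b ∧ a ∈ A ∧ b ∈ A) with hR
  obtain ⟨m, hm, hmax⟩ := Finset.exists_max_image (A.filter (fun x => ¬ R o x)) g
    ⟨x0, by simp [hx0, hx0']⟩
  have key : ∀ y, G.Reachable m y → (y ∈ A ∧ ¬ R o y) ∧ g y = g m := by
    intro y hy
    rw [SimpleGraph.reachable_iff_reflTransGen] at hy
    induction hy with
    | refl => exact ⟨by simpa using hm, rfl⟩
    | @tail b d _ hbd ih =>
      obtain ⟨⟨hbA, hbR⟩, hbm⟩ := ih
      have hbo : b ≠ o := by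
        rintro rfl
        exact hbR Relation.ReflTransGen.refl
      have h1 := hg b
      rw [if_neg hbo] at h1
      have hB : ∀ z, G.Adj b z → z ∈ A → ¬ R o z := by
        intro z hz hzA hRz
        exact hbR (hRz.tail ⟨hz.symm, hzA, hbA⟩)
      have h2 : ∀ z ∈ G.neighborFinset b, 0 ≤ g b - g z := by
        intro z hz
        rw [SimpleGraph.mem_neighborFinset] at hz
        by_cases hzA : z ∈ A
        · have := hmax z (by simp [hzA, hB z hz hzA])
          linarith
        · have h3 := (hA b).1 hbA
          have h4 : ¬ t < g z := fun h => hzA ((hA z).2 h)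
          linarith
      have h5 := (Finset.sum_eq_zero_iff_of_nonneg h2).1
        (le_antisymm h1 (Finset.sum_nonneg h2)) d (by simpa using hbd)
      have hdA : d ∈ A := by
        rw [hA]
        have h3 := (hA b).1 hbA
        linarith
      exact ⟨⟨hdA, hB d hbd hdA⟩, by linarith⟩
  exact (key o (hGconn.preconnected m o)).1.2 Relation.ReflTransGen.refl

lemma s13_flow {V : Type*} (G : SimpleGraph V) [G.LocallyFinite]
    (o : V) (g : V → ℝ) (A : Finset V)
    (hg : ∀ x, ∑ z ∈ G.neighborFinset x, (g x - g z) ≤ if x = o then 1 else 0) :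
    ∑ x ∈ A, ∑ y ∈ (G.neighborFinset x).filter (fun y => y ∉ A), (g x - g y) ≤ 1 := by
  have h1 : ∑ x ∈ A, ∑ z ∈ G.neighborFinset x, (g x - g z) ≤ 1 := by
    refine (Finset.sum_le_sum fun x _ => hg x).trans ?_
    rw [Finset.sum_ite_eq']
    split_ifs <;> norm_num
  have h2 : ∑ x ∈ A, ∑ z ∈ G.neighborFinset x, (g x - g z) =
      ∑ x ∈ A, ∑ y ∈ (G.neighborFinset x).filter (fun y => y ∈ A), (g x - g y) +
      ∑ x ∈ A, ∑ y ∈ (G.neighborFinset x).filter (fun y => y ∉ A), (g x - g y) := by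
    rw [← Finset.sum_add_distrib]
    exact Finset.sum_congr rfl fun x _ => (Finset.sum_filter_add_sum_filter_not _ _ _).symm
  have h3 : ∑ x ∈ A, ∑ y ∈ (G.neighborFinset x).filter (fun y => y ∈ A), (g x - g y) =
      ∑ y ∈ A, ∑ x ∈ (G.neighborFinset y).filter (fun x => x ∈ A), (g x - g y) := by
    apply Finset.sum_comm'
    intro x y
    simp only [Finset.mem_filter, SimpleGraph.mem_neighborFinset]
    constructor
    · rintro ⟨a, b, c⟩; exact ⟨⟨b.symm, a⟩, c⟩
    · rintro ⟨⟨a, b⟩, c⟩; exact ⟨b, a.symm, c⟩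
  have h4 : ∑ y ∈ A, ∑ x ∈ (G.neighborFinset y).filter (fun x => x ∈ A), (g x - g y) =
      - ∑ x ∈ A, ∑ y ∈ (G.neighborFinset x).filter (fun y => y ∈ A), (g x - g y) := by
    simp only [← Finset.sum_neg_distrib, neg_sub]
  linarith

lemma s13_step {V : Type*} (G : SimpleGraph V) [G.LocallyFinite]
    (Db : ℕ) (hD : ∀ x, G.degree x ≤ Db) (o : V) (g : V → ℝ) (A A' : Finset V) (t s : ℝ)
    (hs : 0 < s) (hA : ∀ x, x ∈ A ↔ t < g x) (hA' : ∀ x, x ∈ A' ↔ t - 1 / s < g x)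
    (hb : 2 * s ≤ ∑ x ∈ A, (((G.neighborFinset x).filter (fun y => y ∉ A)).card : ℝ))
    (hg : ∀ x, ∑ z ∈ G.neighborFinset x, (g x - g z) ≤ if x = o then 1 else 0) :
    s ≤ Db * ((A'.card : ℝ) - A.card) := by
  have hf := s13_flow G o g A hg
  have hsub : A ⊆ A' := by
    intro x hx
    rw [hA'] 
    have := (hA x).1 hx
    have : 0 < 1 / s := by positivity
    linarith
  have h1 : ∑ x ∈ A, (((G.neighborFinset x).filter (fun y => y ∉ A)).card : ℝ) ≤
      ∑ x ∈ A, ∑ y ∈ (G.neighborFinset x).filter (fun y => y ∉ A),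
        ((if y ∈ A' then (1 : ℝ) else 0) + s * (g x - g y)) := by
    refine Finset.sum_le_sum fun x hx => ?_
    rw [Finset.card_eq_sum_ones, Nat.cast_sum]
    refine Finset.sum_le_sum fun y hy => ?_
    have hy' : y ∉ A := (Finset.mem_filter.1 hy).2
    have hx1 := (hA x).1 hx
    rw [hA, not_lt] at hy'
    split_ifs with h
    · have : 0 ≤ s * (g x - g y) := mul_nonneg hs.le (by linarith)
      push_cast; linarith
    · rw [hA', not_lt] at h
      have : s * (1 / s) ≤ s * (g x - g y) := mul_le_mul_of_nonneg_left (by linarith) hs.le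
      rw [mul_one_div_cancel hs.ne'] at this
      push_cast; linarith
  simp only [Finset.sum_add_distrib, ← Finset.mul_sum] at h1
  have h2 : ∑ x ∈ A, ∑ y ∈ (G.neighborFinset x).filter (fun y => y ∉ A),
      (if y ∈ A' then (1 : ℝ) else 0) ≤ Db * ((A'.card : ℝ) - A.card) := by
    have e : ∑ x ∈ A, ∑ y ∈ (G.neighborFinset x).filter (fun y => y ∉ A),
      (if y ∈ A' then (1 : ℝ) else 0) =
      ∑ y ∈ A' \ A, ∑ x ∈ (G.neighborFinset y).filter (fun x => x ∈ A), (1 : ℝ) := by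
      simp only [← Finset.sum_filter]
      apply Finset.sum_comm'
      intro x y
      simp only [Finset.mem_filter, SimpleGraph.mem_neighborFinset, Finset.mem_sdiff]
      constructor
      · rintro ⟨a, ⟨b, c⟩, d⟩; exact ⟨⟨b.symm, a⟩, d, c⟩
      · rintro ⟨⟨a, b⟩, c, d⟩; exact ⟨b, ⟨a.symm, d⟩, c⟩
    rw [e]
    have : ∀ y ∈ A' \ A, ∑ x ∈ (G.neighborFinset y).filter (fun x => x ∈ A), (1 : ℝ) ≤ Db := by
      intro y _
      rw [Finset.sum_const, nsmul_eq_mul, mul_one]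
      exact_mod_cast (Finset.card_filter_le _ _).trans (hD y)
    refine (Finset.sum_le_sum this).trans ?_
    rw [Finset.sum_const, nsmul_eq_mul, Finset.card_sdiff_of_subset hsub,
      Nat.cast_sub (Finset.card_le_card hsub), mul_comm]
  have h3 : s * ∑ x ∈ A, ∑ y ∈ (G.neighborFinset x).filter (fun y => y ∉ A), (g x - g y) ≤ s * 1 :=
    mul_le_mul_of_nonneg_left hf hs.le
  linarith

lemma s13_bound {V : Type*} (G : SimpleGraph V) [G.LocallyFinite] (hGconn : G.Connected)
    (Db : ℕ) (hD : ∀ x, G.degree x ≤ Db)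
    (o : V) (CIS : ℝ) (hCIS : 0 < CIS)
    (hiso : ∀ A : Finset V, o ∈ A →
      (∀ x ∈ A, Relation.ReflTransGen
        (fun a b => G.Adj a b ∧ a ∈ A ∧ b ∈ A) o x) →
      CIS * A.card ≤
        ∑ x ∈ A, (((G.neighborFinset x).filter (fun y => y ∉ A)).card : ℝ))
    (g : V → ℝ) (F : Finset V) (hF : ∀ x, g x ≠ 0 → x ∈ F)
    (hg : ∀ x, ∑ z ∈ G.neighborFinset x, (g x - g z) ≤ if x = o then 1 else 0) :
    g o ≤ 2 / CIS * (1 + 2 * (Db + 1) / CIS) := by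
  set K := 2 / CIS * (1 + 2 * (Db + 1) / CIS) with hK
  have hKpos : 2 / CIS ≤ K := by
    rw [hK]
    have : 0 < 2 / CIS := by positivity
    have : 0 ≤ 2 * ((Db : ℝ) + 1) / CIS := by positivity
    nlinarith
  have hlev : ∀ t, 0 ≤ t → ∀ x, x ∈ F.filter (fun x => t < g x) ↔ t < g x := by
    intro t ht x
    rw [Finset.mem_filter]
    exact ⟨fun h => h.2, fun h => ⟨hF x (by linarith), h⟩⟩
  have main : ∀ n : ℕ, ∀ t, 0 ≤ t → t < g o →
      F.card - (F.filter (fun x => t < g x)).card ≤ n →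
      t * (F.filter (fun x => t < g x)).card ≤ K := by
    intro n
    induction n with
    | zero => ?_
    | succ n ih => ?_
    all_goals
      intro t ht hto hn
      have hA := hlev t ht
      set A := F.filter (fun x => t < g x) with hAdef
      have hoA : o ∈ A := (hA o).2 hto
      have hb := hiso A hoA (s13_conn G hGconn o g A t hA hoA hg)
      have hApos : 0 < (A.card : ℝ) := by exact_mod_cast Finset.card_pos.2 ⟨o, hoA⟩
      set s := CIS * A.card / 2 with hs
      have hspos : 0 < s := by positivity
      have hsA : 1 / s * A.card = 2 / CIS := by rw [hs]; field_simp
      by_cases ht' : t - 1 / s < 0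
      · have : t * A.card ≤ 1 / s * A.card := mul_le_mul_of_nonneg_right (by linarith) hApos.le
        linarith
      rw [not_lt] at ht'
      have hA' := hlev _ ht'
      have hstep := s13_step G Db hD o g A _ t s hspos hA hA' (by rw [hs]; linarith) hg
      have hss : 0 < 1 / s := by positivity
      have hle : (F.filter (fun x => t - 1 / s < g x)).card ≤ F.card := Finset.card_filter_le _ _
      have hlt : A.card < (F.filter (fun x => t - 1 / s < g x)).card := by
        by_contra hc
        rw [not_lt] at hc
        have hc' : ((F.filter (fun x => t - 1 / s < g x)).card : ℝ) ≤ A.card := by exact_mod_cast hc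
        have : (Db : ℝ) * (((F.filter (fun x => t - 1 / s < g x)).card : ℝ) - A.card) ≤ 0 :=
          mul_nonpos_of_nonneg_of_nonpos (by positivity) (by linarith)
        linarith
    · omega
    · have h6 := ih (t - 1 / s) ht' (by linarith) (by omega)
      set a' := ((F.filter (fun x => t - 1 / s < g x)).card : ℝ) with ha'
      have hlt' : (A.card : ℝ) < a' := by rw [ha']; exact_mod_cast hlt
      have h7 : s ≤ (Db + 1) * (a' - A.card) := by nlinarith
      have h8 : (A.card : ℝ) * (1 + CIS / (2 * (Db + 1))) ≤ a' := by
        have : (A.card : ℝ) * (CIS / (2 * (Db + 1))) = s / (Db + 1) := by rw [hs]; field_simp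
        have h9 : s / (Db + 1) ≤ a' - A.card := by
          rw [div_le_iff₀ (by positivity)]; linarith
        linarith
      have h9 : (t - 1 / s) * ((A.card : ℝ) * (1 + CIS / (2 * (Db + 1)))) ≤ K :=
        (mul_le_mul_of_nonneg_left h8 ht').trans h6
      have hr : 0 < 1 + CIS / (2 * ((Db : ℝ) + 1)) := by positivity
      have hKr : K = (2 / CIS * (2 * (Db + 1) / CIS)) * (1 + CIS / (2 * ((Db : ℝ) + 1))) := by
        rw [hK]; field_simp; ring
      have h10 : (t - 1 / s) * (A.card : ℝ) ≤ 2 / CIS * (2 * (Db + 1) / CIS) := by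
        rw [hKr, ← mul_assoc] at h9
        exact le_of_mul_le_mul_right h9 hr
      have h11 : K = 2 / CIS + 2 / CIS * (2 * (Db + 1) / CIS) := by rw [hK]; ring
      have h12 : t * (A.card : ℝ) = (t - 1 / s) * A.card + 1 / s * A.card := by ring
      linarith
  by_contra hc
  rw [not_le] at hc
  have hK0 : 0 < K := lt_of_lt_of_le (by positivity) hKpos
  obtain ⟨t, ht1, ht2⟩ := exists_between hc
  have h1 := main _ t (by linarith) ht2 le_rfl
  have hoA : o ∈ F.filter (fun x => t < g x) := (hlev t (by linarith) o).2 ht2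
  have : 1 ≤ ((F.filter (fun x => t < g x)).card : ℝ) := by
    exact_mod_cast Finset.card_pos.2 ⟨o, hoA⟩
  nlinarith

lemma s13_succ {V : Type*} (G : SimpleGraph V) [G.LocallyFinite] (k : ℕ) (o x : V) :
    kerPow (srwKernel G) (k + 1) o x =
      ∑ z ∈ G.neighborFinset x, kerPow (srwKernel G) k o z / G.degree z := by
  show ∑' z, kerPow (srwKernel G) k o z * srwKernel G z x = _
  rw [tsum_eq_sum (s := G.neighborFinset x)]
  · refine Finset.sum_congr rfl fun z hz => ?_
    rw [SimpleGraph.mem_neighborFinset] at hz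
    simp [srwKernel, hz.symm, div_eq_mul_inv]
  · intro z hz
    rw [SimpleGraph.mem_neighborFinset] at hz
    have : ¬ G.Adj z x := fun h => hz h.symm
    simp [srwKernel, this]

lemma s13_nonneg {V : Type*} (G : SimpleGraph V) [G.LocallyFinite] (k : ℕ) (o x : V) :
    0 ≤ kerPow (srwKernel G) k o x := by
  induction k generalizing x with
  | zero => simp only [kerPow]; split_ifs <;> norm_num
  | succ k ih =>
    rw [s13_succ]
    exact Finset.sum_nonneg fun z _ => div_nonneg (ih z) (Nat.cast_nonneg _)

lemma s13_supp {V : Type*} (G : SimpleGraph V) [G.LocallyFinite] (k : ℕ) (o : V) :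
    ∃ F : Finset V, ∀ x, kerPow (srwKernel G) k o x ≠ 0 → x ∈ F := by
  induction k with
  | zero =>
    refine ⟨{o}, fun x hx => ?_⟩
    by_contra h
    rw [Finset.mem_singleton] at h
    exact hx (by simp only [kerPow]; rw [if_neg (Ne.symm h)])
  | succ k ih =>
    obtain ⟨F, hF⟩ := ih
    refine ⟨F.biUnion fun z => G.neighborFinset z, fun x hx => ?_⟩
    rw [s13_succ] at hx
    obtain ⟨z, hz, hz'⟩ := Finset.exists_ne_zero_of_sum_ne_zero hx
    rw [Finset.mem_biUnion]
    refine ⟨z, hF z fun h => hz' (by rw [h, zero_div]), ?_⟩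
    rw [SimpleGraph.mem_neighborFinset] at hz ⊢
    exact hz.symm

/-- Thomassen-type criterion, strong case: an infinite connected bounded-degree
graph satisfying the anchored isoperimetric inequality `|∂A| ≥ C_IS |A|` for all
finite connected `A ∋ o` carries a transient simple random walk (the Green
function at the root is finite). -/
theorem statement13 {V : Type*} [Countable V] [Infinite V]
    (G : SimpleGraph V) [G.LocallyFinite] (hGconn : G.Connected)
    (Db : ℕ) (hD : ∀ x, G.degree x ≤ Db)
    (o : V) (CIS : ℝ) (hCIS : 0 < CIS)
    (hiso : ∀ A : Finset V, o ∈ A →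
      (∀ x ∈ A, Relation.ReflTransGen
        (fun a b => G.Adj a b ∧ a ∈ A ∧ b ∈ A) o x) →
      CIS * A.card ≤
        ∑ x ∈ A, (((G.neighborFinset x).filter (fun y => y ∉ A)).card : ℝ)) :
    Summable fun k : ℕ => kerPow (srwKernel G) k o o := by
  have hdeg : ∀ x, (0 : ℝ) < G.degree x := fun x => by
    exact_mod_cast hGconn.preconnected.degree_pos_of_nontrivial x
  refine summable_of_sum_range_le (c := 2 / CIS * (1 + 2 * (Db + 1) / CIS) * G.degree o)
    (fun k => s13_nonneg G k o o) fun n => ?_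
  choose F hF using fun k => s13_supp G k o
  have h := s13_bound G hGconn Db hD o CIS hCIS hiso
    (fun x => ∑ k ∈ Finset.range n, kerPow (srwKernel G) k o x / G.degree x)
    ((Finset.range n).biUnion F) ?_ ?_
  · simp only [← Finset.sum_div] at h
    rwa [div_le_iff₀ (hdeg o)] at h
  · intro x hx
    obtain ⟨k, hk, hk'⟩ := Finset.exists_ne_zero_of_sum_ne_zero hx
    rw [Finset.mem_biUnion]
    exact ⟨k, hk, hF k x fun h => hk' (by rw [h, zero_div])⟩
  · intro x
    rw [Finset.sum_sub_distrib, Finset.sum_const, G.card_neighborFinset_eq_degree,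
      nsmul_eq_mul, ← Finset.sum_div, mul_div_cancel₀ _ (hdeg x).ne',
      Finset.sum_comm (s := G.neighborFinset x),
      Finset.sum_congr rfl fun k _ => (s13_succ G k o x).symm,
      ← Finset.sum_sub_distrib, Finset.sum_range_sub']
    have h0 := s13_nonneg G n o x
    have h1 : kerPow (srwKernel G) 0 o x = if x = o then 1 else 0 := by
      simp only [kerPow, eq_comm]
    rw [← h1]
    linarith
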